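/- Any admissible rate triplet (r0,r1,r2) for the zero-error binary adder channel with an additional common message satisfies r0 + r1 + r2 ≤ max over η ∈ [h⁻¹(r1), 1/2] of min{ L(η), J(h⁻¹(r1),η) + r0 }. -/

import Mathlib

/-- The binary entropy function (base 2). -/
noncomputable def binH (p : ℝ) : ℝ :=
  -(p * Real.logb 2 p) - (1 - p) * Real.logb 2 (1 - p)

/-- The inverse of the binary entropy function, restricted to `[0, 1/2]`. -/
noncomputable def binHInv (y : ℝ) : ℝ :=
  sInf {p : ℝ | 0 ≤ p ∧ p ≤ 1 / 2 ∧ binH p = y}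

/-- `p ⋆ q = p(1-q) + q(1-p)`. -/
def star (p q : ℝ) : ℝ := p * (1 - q) + q * (1 - p)

/-- `L(η) = h(η) + 1 - η`. -/
noncomputable def Lfun (η : ℝ) : ℝ := binH η + 1 - η

/-- The function `J(p, η)`. -/
noncomputable def Jfun (p η : ℝ) : ℝ :=
  if star p p ≤ η then
    2 * binH (1 / 2 * (1 - Real.sqrt (1 - 2 * η))) - η
  else
    2 * binH (1 / 2 * (1 - (1 - η - star p p) / Real.sqrt (1 - 2 * star p p)))
      - 1 / 2 * (1 - (1 - η - star p p) ^ 2 / (1 - 2 * star p p))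

/-- A family of codebook pairs forms a zero-error system: the map
`(i, a, b) ↦ a + b` is injective on the disjoint union of the `C1 i × C2 i`. -/
def ZeroErrorSystem {n M0 : ℕ} (C1 C2 : Fin M0 → Finset (Fin n → Fin 2)) : Prop :=
  Set.InjOn
    (fun p : Fin M0 × (Fin n → Fin 2) × (Fin n → Fin 2) =>
      fun i : Fin n => (p.2.1 i : ℕ) + (p.2.2 i : ℕ))
    {p : Fin M0 × (Fin n → Fin 2) × (Fin n → Fin 2) | p.2.1 ∈ C1 p.1 ∧ p.2.2 ∈ C2 p.1}

/-- `(r0, r1, r2)` is admissible for the zero-error binary adder channel with an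
additional common message. -/
def AdmissibleTriplet (r0 r1 r2 : ℝ) : Prop :=
  0 ≤ r0 ∧ 0 ≤ r1 ∧ 0 ≤ r2 ∧
    ∀ ε : ℝ, 0 < ε → ∀ N : ℕ, ∃ n : ℕ, N ≤ n ∧
      ∃ M0 M1 M2 : ℕ, ∃ C1 C2 : Fin M0 → Finset (Fin n → Fin 2),
        (∀ i, (C1 i).card = M1) ∧ (∀ i, (C2 i).card = M2) ∧ ZeroErrorSystem C1 C2 ∧
        (2 : ℝ) ^ ((n : ℝ) * (r0 - ε)) ≤ M0 ∧
        (2 : ℝ) ^ ((n : ℝ) * (r1 - ε)) ≤ M1 ∧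
        (2 : ℝ) ^ ((n : ℝ) * (r2 - ε)) ≤ M2


theorem subadd {β ι α : Type*} [Fintype ι] [DecidableEq ι] [Fintype α] [DecidableEq α]
    (S : Finset β) (g : β → ι → α) (hg : Set.InjOn g S) (hS : S.Nonempty) (q : ι → α → ℝ)
    (hq : ∀ j c, q j c = (∑ x ∈ S, if g x j = c then (1:ℝ) else 0) / (S.card : ℝ)) :
    Real.log S.card ≤ ∑ j, ∑ c, Real.negMulLog (q j c) := by
  classical
  have hM : (0:ℝ) < S.card := by exact_mod_cast hS.card_pos
  have hq0 : ∀ j c, 0 ≤ q j c := by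
    intro j c; rw [hq]; positivity
  have hq1 : ∀ j, ∑ c, q j c = 1 := by
    intro j
    simp_rw [hq]
    rw [← Finset.sum_div, Finset.sum_comm]
    simp [hM.ne']
  have hpos : ∀ j, ∀ x ∈ S, 0 < q j (g x j) := by
    intro j x hx
    rw [hq]
    apply div_pos _ hM
    apply Finset.sum_pos'
    · intro y _; positivity
    · exact ⟨x, hx, by simp⟩
  have hsum : ∑ x ∈ S, ∏ j, q j (g x j) ≤ 1 := by
    have h1 : ∑ s : ι → α, ∏ j, q j (s j) = 1 := by
      have := Finset.prod_univ_sum (fun _ : ι => (Finset.univ : Finset α)) q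
      rw [Fintype.piFinset_univ] at this
      rw [← this]
      simp [hq1]
    rw [← h1, ← Finset.sum_image (f := fun s : ι → α => ∏ j, q j (s j)) hg]
    apply Finset.sum_le_univ_sum_of_nonneg
    intro s
    exact Finset.prod_nonneg (fun j _ => hq0 _ _)
  have h2 : ∀ x ∈ S, Real.log S.card + ∑ j, Real.log (q j (g x j)) ≤
      S.card * ∏ j, q j (g x j) - 1 := by
    intro x hx
    have hp : 0 < ∏ j, q j (g x j) := Finset.prod_pos (fun j _ => hpos j x hx)
    rw [← Real.log_prod (fun j _ => (hpos j x hx).ne'), ← Real.log_mul hM.ne' hp.ne']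
    exact Real.log_le_sub_one_of_pos (mul_pos hM hp)
  have h3 := Finset.sum_le_sum h2
  rw [Finset.sum_add_distrib, Finset.sum_sub_distrib, ← Finset.mul_sum] at h3
  simp only [Finset.sum_const, nsmul_eq_mul, mul_one] at h3
  have h4 : ∑ x ∈ S, ∑ j, Real.log (q j (g x j)) =
      - (S.card * ∑ j, ∑ c, Real.negMulLog (q j c)) := by
    rw [Finset.sum_comm, Finset.mul_sum, ← Finset.sum_neg_distrib]
    refine Finset.sum_congr rfl fun j _ => ?_
    have : ∀ c, Real.negMulLog (q j c) = - ((∑ x ∈ S, if g x j = c then Real.log (q j c) else 0) / S.card) := by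
      intro c
      rw [Real.negMulLog, neg_mul]
      nth_rewrite 1 [hq j c]
      rw [div_mul_eq_mul_div, Finset.sum_mul]
      simp
    simp_rw [this]
    rw [Finset.sum_neg_distrib, ← Finset.sum_div, Finset.sum_comm]
    simp
    field_simp
  rw [h4] at h3
  have h5 : (S.card:ℝ) * ∑ x ∈ S, ∏ j, q j (g x j) ≤ S.card * 1 :=
    mul_le_mul_of_nonneg_left hsum hM.le
  have h6 : (S.card:ℝ) * Real.log S.card ≤ S.card * ∑ j, ∑ c, Real.negMulLog (q j c) := by linarith
  exact le_of_mul_le_mul_left h6 hM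

noncomputable def HH (s : ℝ) : ℝ := Real.binEntropy ((1 - √s) / 2)
noncomputable def GG (w : ℝ) : ℝ := 2 * HH w - (1 - w) / 2 * Real.log 2
noncomputable def LL (η : ℝ) : ℝ := Real.binEntropy η + (1 - η) * Real.log 2

theorem HH_cont : Continuous HH := by unfold HH; fun_prop
theorem GG_cont : Continuous GG := by unfold GG; have := HH_cont; fun_prop
theorem LL_cont : Continuous LL := by unfold LL; fun_prop

theorem HH_sq (x : ℝ) : HH (x ^ 2) = Real.binEntropy ((1 - x) / 2) := by
  unfold HH
  rw [Real.sqrt_sq_eq_abs]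
  rcases abs_cases x with ⟨h, _⟩ | ⟨h, _⟩ <;> rw [h]
  rw [← Real.binEntropy_one_sub]; congr 1; ring

theorem HH_deriv {s : ℝ} (h0 : 0 < s) (h1 : s < 1) :
    HasDerivAt HH (-(1/4) * ((Real.log (1 + √s) - Real.log (1 - √s)) / √s)) s := by
  have hz0 : 0 < √s := Real.sqrt_pos.2 h0
  have hz1 : √s < 1 := by rw [Real.sqrt_lt' one_pos]; simpa using h1
  have e := Real.hasDerivAt_binEntropy (p := (1 - √s)/2) (by linarith) (by linarith)
  have e2 := ((Real.hasDerivAt_sqrt h0.ne').const_sub 1).div_const 2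
  have e3 := e.comp s e2
  refine e3.congr_deriv ?_
  have a1 : 1 - (1 - √s)/2 = (1 + √s)/2 := by ring
  rw [a1, Real.log_div (by linarith) (by norm_num), Real.log_div (by linarith) (by norm_num)]
  field_simp
  ring

theorem ratio_hasSum {s : ℝ} (h0 : 0 < s) (h1 : s < 1) :
    HasSum (fun k : ℕ => (2:ℝ) * (1 / (2 * k + 1)) * s ^ k)
      ((Real.log (1 + √s) - Real.log (1 - √s)) / √s) := by
  have hz0 : 0 < √s := Real.sqrt_pos.2 h0
  have hz1 : √s < 1 := by rw [Real.sqrt_lt' one_pos]; simpa using h1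
  have := (Real.hasSum_log_sub_log_of_abs_lt_one (x := √s) (by rw [abs_of_pos hz0]; exact hz1)).div_const (√s)
  have e : (fun k : ℕ => (2:ℝ) * (1 / (2 * k + 1)) * s ^ k) =
      fun k : ℕ => (2:ℝ) * (1 / (2 * k + 1)) * √s ^ (2 * k + 1) / √s := by
    funext k
    rw [pow_succ, pow_mul, Real.sq_sqrt h0.le]
    field_simp
  rw [e]
  exact this

theorem ratio_mono {s s' : ℝ} (h0 : 0 < s) (hs : s ≤ s') (h1 : s' < 1) :
    (Real.log (1 + √s) - Real.log (1 - √s)) / √s ≤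
    (Real.log (1 + √s') - Real.log (1 - √s')) / √s' := by
  refine hasSum_le (fun k => ?_) (ratio_hasSum h0 (by linarith)) (ratio_hasSum (by linarith) h1)
  gcongr

theorem ratio_ge {s : ℝ} (h0 : 0 < s) (h1 : s < 1) :
    2 ≤ (Real.log (1 + √s) - Real.log (1 - √s)) / √s := by
  have := le_hasSum (ratio_hasSum h0 h1) 0 (fun k _ => by positivity)
  simpa using this

theorem HH_concave : ConcaveOn ℝ (Set.Icc 0 1) HH := by
  apply AntitoneOn.concaveOn_of_deriv (convex_Icc 0 1) HH_cont.continuousOn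
  · rw [interior_Icc]
    intro s hs
    exact (HH_deriv hs.1 hs.2).differentiableAt.differentiableWithinAt
  · rw [interior_Icc]
    intro s hs s' hs' hle
    rw [(HH_deriv hs.1 hs.2).deriv, (HH_deriv hs'.1 hs'.2).deriv]
    have := ratio_mono hs.1 hle hs'.2
    linarith

theorem GG_concave : ConcaveOn ℝ (Set.Icc 0 1) GG := by
  have h := HH_concave
  refine ⟨h.1, fun x hx y hy a b ha hb hab => ?_⟩
  have := h.2 hx hy ha hb hab
  simp only [smul_eq_mul, GG] at *
  have hb' : b = 1 - a := by linarith
  subst hb'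
  nlinarith

theorem GG_anti : AntitoneOn GG (Set.Icc 0 1) := by
  have hd : ∀ s ∈ Set.Ioo (0:ℝ) 1, HasDerivAt GG (2 * (-(1/4) * ((Real.log (1 + √s) - Real.log (1 - √s)) / √s)) - (-1)/2 * Real.log 2) s := by
    intro s hs
    exact ((HH_deriv hs.1 hs.2).const_mul 2).sub ((((hasDerivAt_id s).const_sub 1).div_const 2).mul_const _)
  apply antitoneOn_of_deriv_nonpos (convex_Icc 0 1) GG_cont.continuousOn
  · rw [interior_Icc]
    intro s hs
    exact (hd s hs).differentiableAt.differentiableWithinAt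
  · rw [interior_Icc]
    intro s hs
    rw [(hd s hs).deriv]
    have := ratio_ge hs.1 hs.2
    have := Real.log_two_lt_d9
    linarith

theorem HH_strictAnti : StrictAntiOn HH (Set.Icc 0 1) := by
  intro s hs s' hs' hlt
  unfold HH
  have h1 : √s < √s' := Real.sqrt_lt_sqrt hs.1 hlt
  have h2 : √s' ≤ 1 := by simpa using Real.sqrt_le_sqrt hs'.2
  have h3 : 0 ≤ √s := Real.sqrt_nonneg _
  apply Real.binEntropy_strictMonoOn
  · constructor <;> norm_num <;> linarith
  · constructor <;> norm_num <;> linarith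
  · linarith

theorem LL_concave : ConcaveOn ℝ (Set.Icc 0 1) LL := by
  have h := Real.strictConcave_binEntropy.concaveOn
  refine ⟨h.1, fun x hx y hy a b ha hb hab => ?_⟩
  have := h.2 hx hy ha hb hab
  simp only [smul_eq_mul, LL] at *
  have hb' : b = 1 - a := by linarith
  subst hb'
  nlinarith

/-- entropy of a ternary variable -/
theorem ent3_le_LL {p0 p1 p2 : ℝ} (h0 : 0 ≤ p0) (h2 : 0 ≤ p2) (h : p0 + p1 + p2 = 1) :
    Real.negMulLog p0 + Real.negMulLog p1 + Real.negMulLog p2 ≤ LL p1 := by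
  have hc := Real.concaveOn_negMulLog.2 (Set.mem_Ici.2 h0) (Set.mem_Ici.2 h2) 
    (show (0:ℝ) ≤ 1/2 by norm_num) (show (0:ℝ) ≤ 1/2 by norm_num) (by norm_num)
  simp only [smul_eq_mul] at hc
  have e : (1/2:ℝ) * p0 + 1/2 * p2 = (1 - p1) * 2⁻¹ := by linarith
  rw [e, Real.negMulLog_mul] at hc
  have e2 : Real.negMulLog (2⁻¹:ℝ) = 2⁻¹ * Real.log 2 := by
    rw [Real.negMulLog, Real.log_inv]; ring
  rw [e2] at hc
  rw [LL, Real.binEntropy_eq_negMulLog_add_negMulLog_one_sub]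
  linarith

theorem gibbs {p q : ℝ} (hp : 0 ≤ p) (hq : 0 ≤ q) (h : q = 0 → p = 0) :
    Real.negMulLog p ≤ - (p * Real.log q) + q - p := by
  rcases hp.eq_or_lt with rfl | hp
  · simpa using hq
  have hq : 0 < q := lt_of_le_of_ne hq (fun h' => hp.ne' (h h'.symm))
  have := Real.log_le_sub_one_of_pos (div_pos hq hp)
  rw [Real.log_div hq.ne' hp.ne'] at this
  have h2 := mul_le_mul_of_nonneg_left this hp.le
  have : p * (q / p - 1) = q - p := by field_simp
  rw [Real.negMulLog]
  linarith

theorem ent3_le_GG {a b : ℝ} (ha0 : 0 ≤ a) (ha1 : a ≤ 1) (hb0 : 0 ≤ b) (hb1 : b ≤ 1) :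
    Real.negMulLog ((1 - a) * (1 - b)) + Real.negMulLog (a + b - 2 * (a * b)) +
      Real.negMulLog (a * b) ≤ GG (((1 - 2 * a) + (1 - 2 * b)) ^ 2 / 4) := by
  obtain ⟨c, hc⟩ : ∃ c, c = (a + b) / 2 := ⟨_, rfl⟩
  have e : ((1 - 2 * a) + (1 - 2 * b)) ^ 2 / 4 = (1 - 2 * c) ^ 2 := by rw [hc]; ring
  rw [e, GG, HH_sq]
  have e1 : (1 - (1 - 2 * c)) / 2 = c := by ring
  rw [e1, Real.binEntropy_eq_negMulLog_add_negMulLog_one_sub]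
  by_cases hc0 : c = 0
  · have : a = 0 := by linarith
    have : b = 0 := by linarith
    subst_vars; norm_num
  by_cases hc1 : c = 1
  · have : a = 1 := by linarith
    have : b = 1 := by linarith
    subst_vars; norm_num
  have hcp : 0 < c := lt_of_le_of_ne (by linarith) (Ne.symm hc0)
  have hcp1 : 0 < 1 - c := by
    have : c < 1 := lt_of_le_of_ne (by linarith) hc1
    linarith
  have g0 := gibbs (p := (1 - a) * (1 - b)) (q := (1 - c) * (1 - c))
    (mul_nonneg (by linarith) (by linarith)) (by positivity) (fun h => absurd h (by positivity))
  have g1 := gibbs (p := a + b - 2 * (a * b)) (q := 2 * (c * (1 - c)))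
    (by nlinarith [mul_nonneg ha0 (sub_nonneg.2 hb1), mul_nonneg hb0 (sub_nonneg.2 ha1)]) (by positivity) (fun h => absurd h (by positivity))
  have g2 := gibbs (p := a * b) (q := c * c)
    (by positivity) (by positivity) (fun h => absurd h (by positivity))
  rw [Real.log_mul (by positivity) (by positivity)] at g0 g2
  rw [Real.log_mul (by positivity) (by positivity), Real.log_mul (by positivity) (by positivity)] at g1
  have hl2 : 0 ≤ Real.log 2 := Real.log_nonneg (by norm_num)
  have key : 0 ≤ ((a + b - 2 * (a * b)) - 2 * (c * (1 - c))) * Real.log 2 := by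
    apply mul_nonneg _ hl2
    rw [hc]; nlinarith [sq_nonneg (a - b)]
  simp only [Real.negMulLog] at *
  have hb' : b = 2 * c - a := by linarith
  subst hb'
  nlinarith

theorem jensen01 {κ : Type*} [Fintype κ] [Nonempty κ] {f : ℝ → ℝ}
    (hf : ConcaveOn ℝ (Set.Icc 0 1) f) (p : κ → ℝ) (hp : ∀ k, p k ∈ Set.Icc (0:ℝ) 1) :
    ∑ k, f (p k) ≤ (Fintype.card κ : ℝ) * f ((∑ k, p k) / (Fintype.card κ : ℝ)) := by
  have hc : (0:ℝ) < Fintype.card κ := by exact_mod_cast Fintype.card_pos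
  have h := hf.le_map_sum (t := Finset.univ) (w := fun _ => (1:ℝ) / Fintype.card κ) (p := p)
    (fun _ _ => by positivity) (by simp [hc.ne']) (fun k _ => hp k)
  simp only [smul_eq_mul, ← Finset.mul_sum] at h
  have e : (1:ℝ) / Fintype.card κ * ∑ k, p k = (∑ k, p k) / Fintype.card κ := by ring
  rw [e] at h
  have h2 := mul_le_mul_of_nonneg_left h hc.le
  rw [← mul_assoc] at h2
  rwa [mul_one_div_cancel hc.ne', one_mul] at h2

/-- The sum of two bits, as an element of `Fin 3`. -/
def add3 (a b : Fin 2) : Fin 3 := ⟨(a : ℕ) + (b : ℕ), by omega⟩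

theorem add3_ind0 (a b : Fin 2) : (if add3 a b = 0 then (1:ℝ) else 0) =
    (1 - ((a : ℕ) : ℝ)) * (1 - ((b : ℕ) : ℝ)) := by
  fin_cases a <;> fin_cases b <;> simp [add3, Fin.ext_iff]

theorem add3_ind1 (a b : Fin 2) : (if add3 a b = 1 then (1:ℝ) else 0) =
    ((a : ℕ) : ℝ) + ((b : ℕ) : ℝ) - 2 * (((a : ℕ) : ℝ) * ((b : ℕ) : ℝ)) := by
  fin_cases a <;> fin_cases b <;> norm_num [add3, Fin.ext_iff]

theorem add3_ind2 (a b : Fin 2) : (if add3 a b = 2 then (1:ℝ) else 0) =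
    ((a : ℕ) : ℝ) * ((b : ℕ) : ℝ) := by
  fin_cases a <;> fin_cases b <;> norm_num [add3, Fin.ext_iff]

theorem ind2_0 (a : Fin 2) : (if a = 0 then (1:ℝ) else 0) = 1 - ((a : ℕ) : ℝ) := by
  fin_cases a <;> simp

theorem ind2_1 (a : Fin 2) : (if a = 1 then (1:ℝ) else 0) = ((a : ℕ) : ℝ) := by
  fin_cases a <;> simp

/-- Fraction of codewords with a one in coordinate `j`. -/
noncomputable def frac {n : ℕ} (C : Finset (Fin n → Fin 2)) (j : Fin n) : ℝ :=
  (∑ c ∈ C, ((c j : ℕ) : ℝ)) / (C.card : ℝ)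

theorem frac_nonneg {n : ℕ} (C : Finset (Fin n → Fin 2)) (j : Fin n) : 0 ≤ frac C j := by
  unfold frac; positivity

theorem frac_le_one {n : ℕ} (C : Finset (Fin n → Fin 2)) (j : Fin n) : frac C j ≤ 1 := by
  unfold frac
  apply div_le_one_of_le₀ _ (by positivity)
  calc ∑ c ∈ C, ((c j : ℕ) : ℝ) ≤ ∑ c ∈ C, (1:ℝ) := by
        apply Finset.sum_le_sum
        intro c _
        exact_mod_cast Nat.lt_succ_iff.1 (c j).2
    _ = C.card := by simp

theorem frac_sum {n : ℕ} {C : Finset (Fin n → Fin 2)} (hC : C.Nonempty) (j : Fin n) :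
    ∑ c ∈ C, ((c j : ℕ) : ℝ) = C.card * frac C j := by
  have : (0:ℝ) < C.card := by exact_mod_cast hC.card_pos
  unfold frac; field_simp

theorem single_bound {n : ℕ} {C : Finset (Fin n → Fin 2)} (hC : C.Nonempty) :
    Real.log C.card ≤ ∑ j, HH ((1 - 2 * frac C j) ^ 2) := by
  have hM : (0:ℝ) < C.card := by exact_mod_cast hC.card_pos
  refine (subadd C id (Function.injective_id.injOn) hC
    (fun j c => (∑ x ∈ C, if x j = c then (1:ℝ) else 0) / (C.card : ℝ)) (fun j c => rfl)).trans
    (le_of_eq ?_)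
  refine Finset.sum_congr rfl fun j _ => ?_
  rw [HH_sq, Fin.sum_univ_two]
  simp_rw [ind2_0, ind2_1, Finset.sum_sub_distrib, frac_sum hC]
  rw [Real.binEntropy_eq_negMulLog_add_negMulLog_one_sub]
  have e1 : (∑ x ∈ C, (1:ℝ) - C.card * frac C j) / C.card = 1 - frac C j := by
    simp; field_simp
  have e2 : (C.card * frac C j) / C.card = frac C j := by field_simp
  have e3 : (1 - (1 - 2 * frac C j)) / 2 = frac C j := by ring
  rw [e1, e2, e3, add_comm]

section pair
variable {n : ℕ} {A B : Finset (Fin n → Fin 2)}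

theorem pair_ind2 (hA : A.Nonempty) (hB : B.Nonempty) (j : Fin n) :
    ∑ x ∈ A ×ˢ B, (if add3 (x.1 j) (x.2 j) = 2 then (1:ℝ) else 0) =
      (A.card * B.card : ℝ) * (frac A j * frac B j) := by
  simp_rw [add3_ind2]
  rw [Finset.sum_product]
  dsimp only
  rw [← Finset.sum_mul_sum, frac_sum hA, frac_sum hB]
  ring

theorem pair_ind0 (hA : A.Nonempty) (hB : B.Nonempty) (j : Fin n) :
    ∑ x ∈ A ×ˢ B, (if add3 (x.1 j) (x.2 j) = 0 then (1:ℝ) else 0) =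
      (A.card * B.card : ℝ) * ((1 - frac A j) * (1 - frac B j)) := by
  simp_rw [add3_ind0]
  rw [Finset.sum_product]
  dsimp only
  rw [← Finset.sum_mul_sum, Finset.sum_sub_distrib, Finset.sum_sub_distrib,
    frac_sum hA, frac_sum hB]
  simp
  ring

theorem pair_ind1 (hA : A.Nonempty) (hB : B.Nonempty) (j : Fin n) :
    ∑ x ∈ A ×ˢ B, (if add3 (x.1 j) (x.2 j) = 1 then (1:ℝ) else 0) =
      (A.card * B.card : ℝ) * (frac A j + frac B j - 2 * (frac A j * frac B j)) := by
  simp_rw [add3_ind1]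
  rw [Finset.sum_product]
  simp only [Finset.sum_sub_distrib, Finset.sum_add_distrib, ← Finset.mul_sum,
    frac_sum hA, frac_sum hB, Finset.sum_const, nsmul_eq_mul]
  rw [← Finset.sum_mul, frac_sum hA]
  ring

theorem pair_bound (hA : A.Nonempty) (hB : B.Nonempty)
    (hinj : Set.InjOn (fun (x : (Fin n → Fin 2) × (Fin n → Fin 2)) j => add3 (x.1 j) (x.2 j))
      (A ×ˢ B : Finset _)) :
    Real.log (A.card * B.card : ℝ) ≤
      ∑ j, GG (((1 - 2 * frac A j) + (1 - 2 * frac B j)) ^ 2 / 4) := by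
  have hMA : (0:ℝ) < A.card := by exact_mod_cast hA.card_pos
  have hMB : (0:ℝ) < B.card := by exact_mod_cast hB.card_pos
  have h := subadd (A ×ˢ B) _ hinj (hA.product hB) _ (fun j c => rfl)
  rw [Finset.card_product] at h
  push_cast at h
  refine h.trans (Finset.sum_le_sum fun j _ => ?_)
  rw [Fin.sum_univ_three, pair_ind0 hA hB, pair_ind1 hA hB, pair_ind2 hA hB]
  have e : ∀ z : ℝ, (A.card * B.card : ℝ) * z / (A.card * B.card : ℝ) = z := by
    intro z; field_simp
  rw [e, e, e]
  exact ent3_le_GG (frac_nonneg _ _) (frac_le_one _ _) (frac_nonneg _ _) (frac_le_one _ _)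
end pair

theorem total_bound {n M0 M1 M2 : ℕ} {C1 C2 : Fin M0 → Finset (Fin n → Fin 2)}
    (h1 : ∀ i, (C1 i).card = M1) (h2 : ∀ i, (C2 i).card = M2)
    (h0 : 0 < M0) (hM1 : 0 < M1) (hM2 : 0 < M2) (hz : ZeroErrorSystem C1 C2) :
    Real.log (M0 * (M1 * M2) : ℝ) ≤
      ∑ j, LL ((∑ i, (frac (C1 i) j + frac (C2 i) j - 2 * (frac (C1 i) j * frac (C2 i) j))) / M0) := by
  have n1 : ∀ i, (C1 i).Nonempty := fun i => Finset.card_pos.1 (by rw [h1]; exact hM1)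
  have n2 : ∀ i, (C2 i).Nonempty := fun i => Finset.card_pos.1 (by rw [h2]; exact hM2)
  have p0 : (0:ℝ) < M0 := by exact_mod_cast h0
  have p1 : (0:ℝ) < M1 := by exact_mod_cast hM1
  have p2 : (0:ℝ) < M2 := by exact_mod_cast hM2
  let S : Finset (Σ _ : Fin M0, (Fin n → Fin 2) × (Fin n → Fin 2)) :=
    (Finset.univ : Finset (Fin M0)).sigma (fun i => C1 i ×ˢ C2 i)
  have hcard : (S.card : ℝ) = M0 * (M1 * M2) := by
    simp [S, Finset.card_sigma, h1, h2]
  have hne : S.Nonempty := by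
    apply Finset.card_pos.1
    have : (0:ℝ) < S.card := by rw [hcard]; positivity
    exact_mod_cast this
  have hinj : Set.InjOn (fun (x : Σ _ : Fin M0, (Fin n → Fin 2) × (Fin n → Fin 2)) (j : Fin n) =>
      add3 (x.2.1 j) (x.2.2 j)) S := by
    rintro ⟨i, a, b⟩ hx ⟨i', a', b'⟩ hy hxy
    have hx' : a ∈ C1 i ∧ b ∈ C2 i := by simpa [S] using hx
    have hy' : a' ∈ C1 i' ∧ b' ∈ C2 i' := by simpa [S] using hy
    have := @hz (i, a, b) hx' (i', a', b') hy' (by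
      funext j
      have := congrFun hxy j
      simpa [add3, Fin.ext_iff] using this)
    simp only [Prod.mk.injEq] at this
    obtain ⟨rfl, rfl, rfl⟩ := this
    rfl
  have h := subadd S _ hinj hne _ (fun j c => rfl)
  rw [hcard] at h
  refine h.trans (Finset.sum_le_sum fun j _ => ?_)
  rw [Fin.sum_univ_three]
  simp only [S, Finset.sum_sigma, pair_ind0 (n1 _) (n2 _), pair_ind1 (n1 _) (n2 _),
    pair_ind2 (n1 _) (n2 _), h1, h2, ← Finset.mul_sum]
  have e : ∀ z : ℝ, (M1 * M2 : ℝ) * z / (M0 * (M1 * M2) : ℝ) = z / M0 := by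
    intro z; field_simp
  rw [e, e, e]
  apply ent3_le_LL
  · apply div_nonneg _ p0.le
    apply Finset.sum_nonneg
    intro i _
    exact mul_nonneg (sub_nonneg.2 (frac_le_one _ _)) (sub_nonneg.2 (frac_le_one _ _))
  · apply div_nonneg _ p0.le
    apply Finset.sum_nonneg
    intro i _
    exact mul_nonneg (frac_nonneg _ _) (frac_nonneg _ _)
  · rw [← add_div, ← add_div, ← Finset.sum_add_distrib, ← Finset.sum_add_distrib]
    rw [Finset.sum_congr rfl (g := fun _ => (1:ℝ)) (fun i _ => by ring)]
    simp [p0.ne']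

theorem finite_bound {n M0 M1 M2 : ℕ} {C1 C2 : Fin M0 → Finset (Fin n → Fin 2)}
    (h1 : ∀ i, (C1 i).card = M1) (h2 : ∀ i, (C2 i).card = M2)
    (hn : 0 < n) (h0 : 0 < M0) (hM1 : 0 < M1) (hM2 : 0 < M2) (hz : ZeroErrorSystem C1 C2) :
    ∃ t u v : ℝ, t ∈ Set.Icc (-1:ℝ) 1 ∧ u ∈ Set.Icc (0:ℝ) 1 ∧ v ∈ Set.Icc (0:ℝ) 1 ∧
      t ^ 2 ≤ u * v ∧ Real.log M1 ≤ n * HH u ∧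
      Real.log (M1 * M2 : ℝ) ≤ n * GG ((u + v + 2 * t) / 4) ∧
      Real.log (M0 * (M1 * M2) : ℝ) ≤ n * LL ((1 - t) / 2) := by
  have n1 : ∀ i, (C1 i).Nonempty := fun i => Finset.card_pos.1 (by rw [h1]; exact hM1)
  have n2 : ∀ i, (C2 i).Nonempty := fun i => Finset.card_pos.1 (by rw [h2]; exact hM2)
  have p0 : (0:ℝ) < M0 := by exact_mod_cast h0
  have pn : (0:ℝ) < n := by exact_mod_cast hn
  have : Nonempty (Fin M0) := ⟨⟨0, h0⟩⟩
  have : Nonempty (Fin n) := ⟨⟨0, hn⟩⟩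
  let x : Fin M0 × Fin n → ℝ := fun k => 1 - 2 * frac (C1 k.1) k.2
  let y : Fin M0 × Fin n → ℝ := fun k => 1 - 2 * frac (C2 k.1) k.2
  have hx1 : ∀ k, x k ≤ 1 := fun k => by
    have := frac_nonneg (C1 k.1) k.2; simp only [x]; linarith
  have hx0 : ∀ k, -1 ≤ x k := fun k => by
    have := frac_le_one (C1 k.1) k.2; simp only [x]; linarith
  have hy1 : ∀ k, y k ≤ 1 := fun k => by
    have := frac_nonneg (C2 k.1) k.2; simp only [y]; linarith
  have hy0 : ∀ k, -1 ≤ y k := fun k => by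
    have := frac_le_one (C2 k.1) k.2; simp only [y]; linarith
  have hcard : (Fintype.card (Fin M0 × Fin n) : ℝ) = M0 * n := by simp
  have hK : (0:ℝ) < M0 * n := by positivity
  have hle : ∀ f : Fin M0 × Fin n → ℝ, (∀ k, f k ≤ 1) → (∑ k, f k) / (M0 * n : ℝ) ≤ 1 := by
    intro f hf
    rw [div_le_one hK, ← hcard]
    calc ∑ k, f k ≤ ∑ k : Fin M0 × Fin n, (1:ℝ) := Finset.sum_le_sum fun k _ => hf k
      _ = _ := by simp
  have hxx : ∀ k, x k ^ 2 ≤ 1 := fun k => by nlinarith [hx0 k, hx1 k]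
  have hyy : ∀ k, y k ^ 2 ≤ 1 := fun k => by nlinarith [hy0 k, hy1 k]
  have hxy : ∀ k, x k * y k ≤ 1 := fun k => by nlinarith [hxx k, hyy k, sq_nonneg (x k - y k)]
  have hxy' : ∀ k, -(x k * y k) ≤ 1 := fun k => by nlinarith [hxx k, hyy k, sq_nonneg (x k + y k)]
  refine ⟨(∑ k, x k * y k) / (M0 * n), (∑ k, x k ^ 2) / (M0 * n), (∑ k, y k ^ 2) / (M0 * n),
    ⟨?_, hle _ hxy⟩, ⟨by positivity, hle _ hxx⟩, ⟨by positivity, hle _ hyy⟩, ?_, ?_, ?_, ?_⟩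
  · have := hle _ hxy'
    rw [Finset.sum_neg_distrib, neg_div] at this
    linarith
  · rw [div_pow, div_mul_div_comm, ← pow_two]
    gcongr
    exact Finset.sum_mul_sq_le_sq_mul_sq _ _ _
  · have hj := jensen01 HH_concave (fun k => x k ^ 2) (fun k => ⟨sq_nonneg _, hxx k⟩)
    rw [hcard, Fintype.sum_prod_type] at hj
    have hs : ∑ i : Fin M0, Real.log M1 ≤ ∑ i, ∑ j, HH (x (i, j) ^ 2) := by
      apply Finset.sum_le_sum
      intro i _
      have := single_bound (n1 i)
      rw [h1] at this
      exact this
    simp only [Finset.sum_const, Finset.card_univ, Fintype.card_fin, nsmul_eq_mul] at hs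
    have := hs.trans hj
    rw [mul_assoc] at this
    exact le_of_mul_le_mul_left this p0
  · have hj := jensen01 GG_concave (fun k => (x k + y k) ^ 2 / 4) (fun k =>
      ⟨by positivity, by nlinarith [hxx k, hyy k, hxy k]⟩)
    rw [hcard, Fintype.sum_prod_type] at hj
    have hs : ∑ i : Fin M0, Real.log (M1 * M2 : ℝ) ≤
        ∑ i, ∑ j, GG ((x (i, j) + y (i, j)) ^ 2 / 4) := by
      apply Finset.sum_le_sum
      intro i _
      have := pair_bound (n1 i) (n2 i) (by
        rintro ⟨a, b⟩ hx ⟨a', b'⟩ hy hxy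
        have hx' : a ∈ C1 i ∧ b ∈ C2 i := by simpa using hx
        have hy' : a' ∈ C1 i ∧ b' ∈ C2 i := by simpa using hy
        have := @hz (i, a, b) hx' (i, a', b') hy' (by
          funext j
          have := congrFun hxy j
          simpa [add3, Fin.ext_iff] using this)
        simp only [Prod.mk.injEq] at this
        obtain ⟨_, rfl, rfl⟩ := this
        rfl)
      rw [h1, h2] at this
      exact this
    simp only [Finset.sum_const, Finset.card_univ, Fintype.card_fin, nsmul_eq_mul] at hs
    have := hs.trans hj
    rw [mul_assoc] at this
    have := le_of_mul_le_mul_left this p0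
    have e : (∑ k, (x k + y k) ^ 2 / 4) / (M0 * n : ℝ) =
      ((∑ k, x k ^ 2) / (M0 * n) + (∑ k, y k ^ 2) / (M0 * n) + 2 * ((∑ k, x k * y k) / (M0 * n))) / 4 := by
      have : ∀ k, (x k + y k) ^ 2 / 4 = (x k ^ 2 + y k ^ 2 + 2 * (x k * y k)) / 4 := fun k => by ring
      simp_rw [this]
      rw [← Finset.sum_div, Finset.sum_add_distrib, Finset.sum_add_distrib, ← Finset.mul_sum]
      ring
    rwa [e] at this
  · have ht := total_bound h1 h2 h0 hM1 hM2 hz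
    have hj := jensen01 LL_concave (fun j : Fin n => (∑ i, (frac (C1 i) j + frac (C2 i) j - 2 * (frac (C1 i) j * frac (C2 i) j))) / (M0:ℝ)) (fun j => by
      have q : ∀ i, frac (C1 i) j + frac (C2 i) j - 2 * (frac (C1 i) j * frac (C2 i) j) = (1 - x (i, j) * y (i, j)) / 2 := by
        intro i; simp only [x, y]; ring
      constructor
      · apply div_nonneg _ p0.le
        apply Finset.sum_nonneg
        intro i _
        rw [q]; linarith [hxy (i, j)]
      · rw [div_le_one p0]
        calc _ ≤ ∑ i : Fin M0, (1:ℝ) := Finset.sum_le_sum fun i _ => by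
              rw [q]; linarith [hxy' (i, j)]
          _ = _ := by simp)
    rw [Fintype.card_fin] at hj
    refine (ht.trans hj).trans (le_of_eq ?_)
    congr 2
    rw [← Finset.sum_div, Finset.sum_comm]
    have q : ∀ i j, frac (C1 i) j + frac (C2 i) j - 2 * (frac (C1 i) j * frac (C2 i) j) = (1 - x (i, j) * y (i, j)) / 2 := by
      intro i j; simp only [x, y]; ring
    simp_rw [q]
    rw [Fintype.sum_prod_type]
    simp_rw [← Finset.sum_div, Finset.sum_sub_distrib]
    simp
    field_simp

theorem log_of_pow {n M : ℕ} {r : ℝ} (h : (2:ℝ) ^ ((n:ℝ) * r) ≤ M) :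
    0 < M ∧ n * r * Real.log 2 ≤ Real.log M := by
  have hp : (0:ℝ) < (2:ℝ) ^ ((n:ℝ) * r) := by positivity
  refine ⟨by exact_mod_cast hp.trans_le h, ?_⟩
  have := Real.log_le_log hp h
  rwa [Real.log_rpow (by norm_num)] at this

theorem limit_bound {r0 r1 r2 : ℝ} (h : AdmissibleTriplet r0 r1 r2) :
    ∃ t u v : ℝ, t ∈ Set.Icc (-1:ℝ) 1 ∧ u ∈ Set.Icc (0:ℝ) 1 ∧ v ∈ Set.Icc (0:ℝ) 1 ∧
      t ^ 2 ≤ u * v ∧ r1 * Real.log 2 ≤ HH u ∧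
      (r1 + r2) * Real.log 2 ≤ GG ((u + v + 2 * t) / 4) ∧
      (r0 + r1 + r2) * Real.log 2 ≤ LL ((1 - t) / 2) := by
  obtain ⟨_, _, _, h⟩ := h
  have hl : 0 < Real.log 2 := Real.log_pos (by norm_num)
  let K : Set (ℝ × ℝ × ℝ) := (Set.Icc (-1:ℝ) 1 ×ˢ Set.Icc (0:ℝ) 1 ×ˢ Set.Icc (0:ℝ) 1) ∩
    {p | p.1 ^ 2 ≤ p.2.1 * p.2.2}
  have hK : IsCompact K := by
    apply IsCompact.inter_right
    · exact isCompact_Icc.prod (isCompact_Icc.prod isCompact_Icc)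
    · exact isClosed_le (by fun_prop) (by fun_prop)
  let φ : ℝ × ℝ × ℝ → ℝ := fun p => min (HH p.2.1 - r1 * Real.log 2)
    (min (GG ((p.2.1 + p.2.2 + 2 * p.1) / 4) - (r1 + r2) * Real.log 2)
      (LL ((1 - p.1) / 2) - (r0 + r1 + r2) * Real.log 2))
  have hφ : Continuous φ := by
    have := HH_cont
    have := GG_cont
    have := LL_cont
    fun_prop
  have key : ∀ ε : ℝ, 0 < ε → ∃ p ∈ K, -(3 * ε * Real.log 2) ≤ φ p := by
    intro ε hε
    obtain ⟨n, hn, M0, M1, M2, C1, C2, h1, h2, hz, b0, b1, b2⟩ := h ε hε 1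
    obtain ⟨q0, b0⟩ := log_of_pow b0
    obtain ⟨q1, b1⟩ := log_of_pow b1
    obtain ⟨q2, b2⟩ := log_of_pow b2
    have p0 : (0:ℝ) < M0 := by exact_mod_cast q0
    have p1 : (0:ℝ) < M1 := by exact_mod_cast q1
    have p2 : (0:ℝ) < M2 := by exact_mod_cast q2
    have pn : (0:ℝ) < n := by exact_mod_cast hn
    obtain ⟨t, u, v, ht, hu, hv, htuv, e1, e2, e3⟩ := finite_bound h1 h2 hn q0 q1 q2 hz
    rw [Real.log_mul p0.ne' (by positivity), Real.log_mul p1.ne' p2.ne'] at e3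
    rw [Real.log_mul p1.ne' p2.ne'] at e2
    have hεl : 0 < ε * Real.log 2 := mul_pos hε hl
    refine ⟨(t, u, v), ⟨⟨ht, hu, hv⟩, htuv⟩, ?_⟩
    simp only [φ]
    refine le_min ?_ (le_min ?_ ?_)
    · have : (n:ℝ) * ((r1 - ε) * Real.log 2) ≤ n * HH u := by linarith
      have := le_of_mul_le_mul_left this pn
      linarith
    · have : (n:ℝ) * ((r1 - ε + (r2 - ε)) * Real.log 2) ≤ n * GG ((u + v + 2 * t) / 4) := by linarith
      have := le_of_mul_le_mul_left this pn
      linarith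
    · have : (n:ℝ) * ((r0 - ε + (r1 - ε) + (r2 - ε)) * Real.log 2) ≤ n * LL ((1 - t) / 2) := by linarith
      have := le_of_mul_le_mul_left this pn
      linarith
  have hKne : K.Nonempty := by
    obtain ⟨p, hp, _⟩ := key 1 one_pos
    exact ⟨p, hp⟩
  obtain ⟨p, hp, hmax⟩ := hK.exists_isMaxOn hKne hφ.continuousOn
  have hnn : 0 ≤ φ p := by
    by_contra hneg
    push Not at hneg
    obtain ⟨p', hp', hle⟩ := key (-(φ p) / (6 * Real.log 2)) (div_pos (by linarith) (by linarith))
    have h1 : φ p' ≤ φ p := hmax hp'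
    have : 3 * (-(φ p) / (6 * Real.log 2)) * Real.log 2 = -(φ p) / 2 := by field_simp; ring
    rw [this] at hle
    linarith
  obtain ⟨t, u, v⟩ := p
  obtain ⟨⟨ht, hu, hv⟩, htuv⟩ := hp
  simp only [φ, le_min_iff, sub_nonneg] at hnn
  exact ⟨t, u, v, ht, hu, hv, htuv, hnn.1, hnn.2.1, hnn.2.2⟩

theorem binH_mul (p : ℝ) : binH p * Real.log 2 = Real.binEntropy p := by
  have hl : 0 < Real.log 2 := Real.log_pos (by norm_num)
  unfold binH Real.binEntropy Real.logb
  rw [Real.log_inv, Real.log_inv]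
  field_simp
  ring

theorem Lfun_mul (η : ℝ) : Lfun η * Real.log 2 = LL η := by
  unfold Lfun LL
  rw [← binH_mul]; ring

theorem Jfun_mul_ge {p t : ℝ} (h : star p p ≤ (1 - t) / 2) :
    Jfun p ((1 - t) / 2) * Real.log 2 = GG t := by
  unfold Jfun GG HH
  rw [if_pos h, ← binH_mul]
  have e : 1 - 2 * ((1 - t) / 2) = t := by ring
  have e2 : (1 / 2 * (1 - √t)) = (1 - √t) / 2 := by ring
  rw [e, e2]; ring

theorem Jfun_mul_lt {p t : ℝ} (hp : 0 < 1 - 2 * p) (h : ¬ star p p ≤ (1 - t) / 2) :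
    Jfun p ((1 - t) / 2) * Real.log 2 =
      GG ((((1 - 2 * p) ^ 2 + t) / (2 * (1 - 2 * p))) ^ 2) := by
  unfold Jfun GG
  rw [if_neg h, HH_sq, ← binH_mul]
  have e : 1 - 2 * star p p = (1 - 2 * p) ^ 2 := by unfold _root_.star; ring
  have e1 : 1 - (1 - t) / 2 - star p p = ((1 - 2 * p) ^ 2 + t) / 2 := by unfold _root_.star; ring
  rw [e, e1, Real.sqrt_sq hp.le, ← div_pow, div_div]
  have e2 : ∀ c : ℝ, 1 / 2 * (1 - c) = (1 - c) / 2 := fun c => by ring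
  rw [e2, e2]; ring

theorem binHInv_spec {y : ℝ} (h0 : 0 ≤ y) (h1 : y ≤ 1) :
    0 ≤ binHInv y ∧ binHInv y ≤ 1 / 2 ∧ binH (binHInv y) = y := by
  have hl : 0 < Real.log 2 := Real.log_pos (by norm_num)
  have hivt := intermediate_value_Icc (show (0:ℝ) ≤ 2⁻¹ by norm_num)
    (Real.binEntropy_continuous.continuousOn)
  obtain ⟨p, hp, hpy⟩ := hivt (show y * Real.log 2 ∈ _ by
    simp only [Real.binEntropy_zero, Real.binEntropy_two_inv]
    constructor
    · positivity
    · nlinarith)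
  have hpy' : binH p = y := by
    rw [← binH_mul] at hpy
    exact mul_right_cancel₀ hl.ne' hpy
  have hset : {p : ℝ | 0 ≤ p ∧ p ≤ 1 / 2 ∧ binH p = y} = {p} := by
    ext q
    simp only [Set.mem_ofPred_eq, Set.mem_singleton_iff]
    constructor
    · rintro ⟨q0, q1, hq⟩
      apply Real.binEntropy_strictMonoOn.injOn ⟨q0, by norm_num; linarith⟩ hp
      rw [← binH_mul, ← binH_mul, hq, hpy']
    · rintro rfl
      exact ⟨hp.1, by simpa using hp.2, hpy'⟩
  have : binHInv y = p := by
    unfold binHInv; rw [hset]; exact csInf_singleton p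
  rw [this]
  exact ⟨hp.1, by simpa using hp.2, hpy'⟩

theorem GG_zero : GG 0 = 3 / 2 * Real.log 2 := by
  have e : ((1:ℝ) - 0) / 2 = 2⁻¹ := by norm_num
  unfold GG HH
  rw [Real.sqrt_zero, e, Real.binEntropy_two_inv]; ring

theorem LL_half : LL (1 / 2) = 3 / 2 * Real.log 2 := by
  have e : (1:ℝ) / 2 = 2⁻¹ := by norm_num
  unfold LL
  rw [e, Real.binEntropy_two_inv]; ring

theorem exists_eta {r0 r1 r2 : ℝ} (h : AdmissibleTriplet r0 r1 r2) :
    ∃ η ∈ Set.Icc (binHInv r1) (1 / 2),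
      r0 + r1 + r2 ≤ min (Lfun η) (Jfun (binHInv r1) η + r0) := by
  have hl : 0 < Real.log 2 := Real.log_pos (by norm_num)
  obtain ⟨t, u, v, ht, hu, hv, htuv, e1, e2, e3⟩ := limit_bound h
  have hr1 : 0 ≤ r1 := h.2.1
  have hr1' : r1 ≤ 1 := by
    have : HH u ≤ Real.log 2 := Real.binEntropy_le_log_two
    nlinarith
  obtain ⟨p0, p1, hp⟩ := binHInv_spec hr1 hr1'
  set p := binHInv r1
  -- `u` is at most `(1 - 2p)^2`
  have hs : (1 - 2 * p) ^ 2 ∈ Set.Icc (0:ℝ) 1 := ⟨sq_nonneg _, by nlinarith⟩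
  have hus : u ≤ (1 - 2 * p) ^ 2 := by
    rw [← HH_strictAnti.le_iff_ge hs hu, HH_sq]
    have : (1 - (1 - 2 * p)) / 2 = p := by ring
    rw [this, ← binH_mul, hp]
    exact e1
  have hw0 : 0 ≤ (u + v + 2 * t) / 4 := by
    linarith [abs_le_of_sq_le_sq' (show (2 * t) ^ 2 ≤ (u + v) ^ 2 by nlinarith [sq_nonneg (u - v)]) (by linarith [hu.1, hv.1]) |>.1]
  have hw1 : (u + v + 2 * t) / 4 ≤ 1 := by linarith [hu.2, hv.2, ht.2]
  have fin : ∀ η, (r0 + r1 + r2) * Real.log 2 ≤ LL η →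
      (r1 + r2) * Real.log 2 ≤ Jfun p η * Real.log 2 →
      r0 + r1 + r2 ≤ min (Lfun η) (Jfun p η + r0) := by
    intro η a b
    rw [← Lfun_mul] at a
    have a := le_of_mul_le_mul_right a hl
    have b := le_of_mul_le_mul_right b hl
    exact le_min a (by linarith)
  by_cases htn : t < 0
  · refine ⟨1 / 2, ⟨p1, le_rfl⟩, fin _ ?_ ?_⟩
    · rw [LL_half]
      refine e3.trans ?_
      unfold LL
      have := Real.binEntropy_le_log_two (p := (1 - t) / 2)
      nlinarith
    · have e : (1:ℝ) / 2 = (1 - 0) / 2 := by norm_num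
      rw [e, Jfun_mul_ge (by unfold _root_.star; nlinarith [sq_nonneg (1 - 2 * p)])]
      exact e2.trans (GG_anti ⟨le_rfl, by norm_num⟩ ⟨hw0, hw1⟩ hw0)
  push Not at htn
  have hta : t ≤ 1 - 2 * p := by
    refine (pow_le_pow_iff_left₀ (by linarith) (by linarith) two_ne_zero).1 ?_
    nlinarith [hv.1, hv.2, hu.1]
  refine ⟨(1 - t) / 2, ⟨by linarith, by linarith⟩, fin _ e3 (e2.trans ?_)⟩
  by_cases hst : star p p ≤ (1 - t) / 2
  · rw [Jfun_mul_ge hst]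
    apply GG_anti ⟨htn, ht.2⟩ ⟨hw0, hw1⟩
    have : 2 * t ≤ u + v := by
      refine (pow_le_pow_iff_left₀ (by linarith) (by linarith [hu.1, hv.1]) two_ne_zero).1 ?_
      nlinarith [sq_nonneg (u - v)]
    linarith
  · have hts : (1 - 2 * p) ^ 2 < t := by
      have : star p p = (1 - (1 - 2 * p) ^ 2) / 2 := by unfold _root_.star; ring
      rw [this] at hst
      push Not at hst
      linarith
    have htp : 0 < t := lt_of_le_of_lt (sq_nonneg _) hts
    have hup : 0 < u := by
      rcases hu.1.eq_or_lt with h' | h'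
      · rw [← h'] at htuv; nlinarith
      · exact h'
    have hap : 0 < 1 - 2 * p := by
      rcases (show 0 ≤ 1 - 2 * p by linarith).eq_or_lt with h' | h'
      · linarith
      · exact h'
    rw [Jfun_mul_lt hap hst]
    have hsp : 0 < (1 - 2 * p) ^ 2 := by positivity
    have hle : (((1 - 2 * p) ^ 2 + t) / (2 * (1 - 2 * p))) ^ 2 ≤ (u + v + 2 * t) / 4 := by
      have e : (((1 - 2 * p) ^ 2 + t) / (2 * (1 - 2 * p))) ^ 2 =
          ((1 - 2 * p) ^ 2 + 2 * t + t ^ 2 / (1 - 2 * p) ^ 2) / 4 := by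
        field_simp; ring
      rw [e]
      generalize (1 - 2 * p) ^ 2 = s at *
      have hv' : t ^ 2 / u ≤ v := by rw [div_le_iff₀ hup]; linarith
      have hd : t ^ 2 / u - t ^ 2 / s = t ^ 2 / (u * s) * (s - u) := by field_simp
      have hd2 : 1 ≤ t ^ 2 / (u * s) := by
        rw [le_div_iff₀ (by positivity)]; nlinarith
      have := mul_le_mul_of_nonneg_right hd2 (sub_nonneg.2 hus)
      linarith
    exact GG_anti ⟨sq_nonneg _, hle.trans hw1⟩ ⟨hw0, hw1⟩ hle

theorem common_message_sum_rate_bound (r0 r1 r2 : ℝ) (h : AdmissibleTriplet r0 r1 r2) :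
    r0 + r1 + r2 ≤
      sSup ((fun η => min (Lfun η) (Jfun (binHInv r1) η + r0)) ''
        Set.Icc (binHInv r1) (1 / 2)) := by
  obtain ⟨η, hη, hle⟩ := exists_eta h
  refine hle.trans (le_csSup ?_ ⟨η, hη, rfl⟩)
  have hl : 0 < Real.log 2 := Real.log_pos (by norm_num)
  refine ⟨2 - binHInv r1, ?_⟩
  rintro _ ⟨z, hz, rfl⟩
  refine (min_le_left _ _).trans ?_
  have h1 : binH z ≤ 1 := by
    have : binH z * Real.log 2 ≤ 1 * Real.log 2 := by
      rw [binH_mul, one_mul]; exact Real.binEntropy_le_log_two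
    exact le_of_mul_le_mul_right this hl
  unfold Lfun
  linarith [hz.1]
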